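/- Let N ≥ 1 and let Ω be the standard symplectic form on ℝ^{2N}. Let S be a symplectic matrix (SΩSᵀ = Ω), let γ be a pure quantum covariance matrix (real positive definite with γ = Ω γ⁻¹ Ωᵀ), and let t ∈ ℝ. Then the matrix S_t := ((SSᵀ) #_t γ)^{1/2} (SSᵀ)^{−1/2} S is symplectic: S_t Ω S_tᵀ = Ω. Moreover S_t S_tᵀ = (SSᵀ) #_t γ, and S_0 = S. -/

import Mathlib

open Matrix
open scoped ComplexOrder

noncomputable section

/-- The standard symplectic form on `ℝ^(2N)`: block diagonal with `N` blocks `[[0,1],[-1,0]]`. -/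
def symp (N : ℕ) : Matrix (Fin (2*N)) (Fin (2*N)) ℝ :=
  Matrix.of fun i j =>
    if i.val % 2 = 0 ∧ j.val = i.val + 1 then 1
    else if j.val % 2 = 0 ∧ i.val = j.val + 1 then -1
    else 0

/-- View a real matrix as a complex matrix. -/
def cplx {n : Type*} (M : Matrix n n ℝ) : Matrix n n ℂ :=
  M.map (fun x => (x : ℂ))

/-- `V` is a bona fide quantum covariance matrix w.r.t. the symplectic form `Om`:
the complex matrix `V + i·Om` is positive semidefinite. -/
def BonaFide {n : Type*} [Fintype n] (V Om : Matrix n n ℝ) : Prop :=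
  (cplx V + Complex.I • cplx Om).PosSemidef

/-- The (positive semidefinite) square root of a positive semidefinite real matrix,
via the continuous functional calculus. -/
def msqrt {n : Type*} [Fintype n] [DecidableEq n] (M : Matrix n n ℝ) : Matrix n n ℝ :=
  cfc Real.sqrt M

/-- `X_V = V^{1/2} (I + A⁻²)^{1/2} V^{1/2}` where `A = V^{1/2} Ω V^{1/2}`. -/
def Xmat {n : Type*} [Fintype n] [DecidableEq n] (V Om : Matrix n n ℝ) : Matrix n n ℝ :=
  msqrt V * msqrt (1 + (msqrt V * Om * msqrt V)⁻¹ * (msqrt V * Om * msqrt V)⁻¹) * msqrt V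

/-- Real power `M^t` of a (symmetric) real matrix, via the continuous functional calculus. -/
def mpowR {n : Type*} [Fintype n] [DecidableEq n] (M : Matrix n n ℝ) (t : ℝ) :
    Matrix n n ℝ :=
  cfc (fun x : ℝ => x ^ t) M

/-- The weighted matrix geometric mean `A #_t B = A^{1/2} (A^{−1/2} B A^{−1/2})^t A^{1/2}`. -/
def geomMeanR {n : Type*} [Fintype n] [DecidableEq n] (t : ℝ) (A B : Matrix n n ℝ) :
    Matrix n n ℝ :=
  mpowR A (1/2) * mpowR (mpowR A (-(1/2)) * B * mpowR A (-(1/2))) t * mpowR A (1/2)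

/-- `S_t := ((SSᵀ) #_t γ)^{1/2} (SSᵀ)^{−1/2} S`. -/
def Smat (N : ℕ) (S γ : Matrix (Fin (2*N)) (Fin (2*N)) ℝ) (t : ℝ) :
    Matrix (Fin (2*N)) (Fin (2*N)) ℝ :=
  msqrt (geomMeanR t (S * Sᵀ) γ) * (msqrt (S * Sᵀ))⁻¹ * S

theorem symp_transpose (N : ℕ) : (symp N)ᵀ = - symp N := by
  ext i j
  simp only [symp, Matrix.transpose_apply, Matrix.of_apply, Matrix.neg_apply]
  split_ifs <;> first | omega | (simp; done) | (exfalso; tauto)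

theorem symp_mul_transpose (N : ℕ) : symp N * (symp N)ᵀ = 1 := by
  ext i j
  rw [Matrix.mul_apply]
  by_cases h : i.val % 2 = 0
  · have hp : i.val + 1 < 2 * N := by omega
    rw [Finset.sum_eq_single ⟨i.val + 1, hp⟩]
    · simp only [symp, Matrix.transpose_apply, Matrix.of_apply, Matrix.one_apply, Fin.ext_iff]
      split_ifs <;> first | omega | (simp; done) | (exfalso; tauto)
    · intro k _ hk
      simp only [ne_eq, Fin.ext_iff] at hk
      simp only [symp, Matrix.transpose_apply, Matrix.of_apply]
      split_ifs <;> first | omega | (simp; done) | (exfalso; tauto)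
    · simp
  · have hp : i.val - 1 < 2 * N := by omega
    rw [Finset.sum_eq_single ⟨i.val - 1, hp⟩]
    · simp only [symp, Matrix.transpose_apply, Matrix.of_apply, Matrix.one_apply, Fin.ext_iff]
      split_ifs <;> first | omega | (simp; done) | (exfalso; tauto)
    · intro k _ hk
      simp only [ne_eq, Fin.ext_iff] at hk
      simp only [symp, Matrix.transpose_apply, Matrix.of_apply]
      split_ifs <;> first | omega | (simp; done) | (exfalso; tauto)
    · simp

section helpers

variable {n : Type*} [Fintype n] [DecidableEq n]

theorem contOn_spec (M : Matrix n n ℝ) (f : ℝ → ℝ) : ContinuousOn f (spectrum ℝ M) :=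
  (Matrix.finite_real_spectrum (A := M)).continuousOn f

theorem spec_pos {W : Matrix n n ℝ} (hW : W.PosDef) {x : ℝ} (hx : x ∈ spectrum ℝ W) : 0 < x := by
  rw [hW.1.spectrum_real_eq_range_eigenvalues] at hx
  obtain ⟨i, rfl⟩ := hx
  exact hW.eigenvalues_pos i

theorem mpowR_mul {W : Matrix n n ℝ} (hW : W.PosDef) (s t : ℝ) :
    mpowR W s * mpowR W t = mpowR W (s + t) := by
  unfold mpowR
  rw [← cfc_mul _ _ W (contOn_spec _ _) (contOn_spec _ _)]
  exact cfc_congr fun x hx => (Real.rpow_add (spec_pos hW hx) s t).symm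

theorem mpowR_zero {W : Matrix n n ℝ} (hW : W.PosDef) : mpowR W 0 = 1 := by
  unfold mpowR
  simp only [Real.rpow_zero]
  exact cfc_const_one ℝ W hW.1

theorem mpowR_one {W : Matrix n n ℝ} (hW : W.PosDef) : mpowR W 1 = W := by
  unfold mpowR
  simp only [Real.rpow_one]
  exact cfc_id' ℝ W hW.1

theorem mpowR_herm (W : Matrix n n ℝ) (t : ℝ) : (mpowR W t)ᴴ = mpowR W t :=
  (cfc_predicate (fun x : ℝ => x ^ t) W : IsSelfAdjoint _)

theorem mpowR_transpose (W : Matrix n n ℝ) (t : ℝ) : (mpowR W t)ᵀ = mpowR W t := by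
  rw [← Matrix.conjTranspose_eq_transpose_of_trivial, mpowR_herm]

theorem mpowR_isUnit {W : Matrix n n ℝ} (hW : W.PosDef) (t : ℝ) : IsUnit (mpowR W t) := by
  have h : mpowR W t * mpowR W (-t) = 1 := by
    rw [mpowR_mul hW, add_neg_cancel, mpowR_zero hW]
  exact IsUnit.of_mul_eq_one _ h

theorem conj_posDef {W P : Matrix n n ℝ} (hW : W.PosDef) (hP : IsUnit P) (hPh : Pᴴ = P) :
    (P * W * P).PosDef := by
  have := (Matrix.IsUnit.posDef_star_right_conjugate_iff (x := W) hP).2 hW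
  rwa [Matrix.star_eq_conjTranspose, hPh] at this

theorem mpowR_posDef {W : Matrix n n ℝ} (hW : W.PosDef) (t : ℝ) : (mpowR W t).PosDef := by
  have := conj_posDef Matrix.PosDef.one (mpowR_isUnit hW (t / 2)) (mpowR_herm W (t / 2))
  rwa [mul_one, mpowR_mul hW, add_halves] at this

theorem msqrt_eq (W : Matrix n n ℝ) : msqrt W = mpowR W (1/2) := by
  unfold msqrt mpowR
  congr 1
  funext x
  exact Real.sqrt_eq_rpow x

theorem mpowR_symp {W J : Matrix n n ℝ} (hJ : J * Jᵀ = 1) (hW : W.PosDef)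
    (h : W * J * W = J) (t : ℝ) : mpowR W t * J * mpowR W t = J := by
  have hJ' : Jᵀ * J = 1 := mul_eq_one_comm.1 hJ
  have hstar : star J = Jᵀ := by
    rw [Matrix.star_eq_conjTranspose, Matrix.conjTranspose_eq_transpose_of_trivial]
  let u : unitary (Matrix n n ℝ) := ⟨J, by
    rw [Unitary.mem_iff, hstar]; exact ⟨hJ', hJ⟩⟩
  obtain ⟨w, hw⟩ := hW.isUnit
  -- J W J^T is the inverse of W
  have hinv : J * W * Jᵀ = ((w⁻¹ : (Matrix n n ℝ)ˣ) : Matrix n n ℝ) := by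
    symm
    apply Units.inv_eq_of_mul_eq_one_right
    rw [hw, ← mul_assoc, ← mul_assoc, h, hJ]
  have hmap := StarAlgHomClass.map_cfc (Unitary.conjStarAlgAut ℝ (Matrix n n ℝ) u)
    (fun x : ℝ => x ^ t) W (contOn_spec _ _)
    (by
      change Continuous fun x => J * x * star J
      fun_prop) hW.1
    (by
      rw [Unitary.conjStarAlgAut_apply]
      exact hW.1.isSelfAdjoint.conjugate J)
  simp only [Unitary.conjStarAlgAut_apply] at hmap
  change J * mpowR W t * star J = cfc (fun x : ℝ => x ^ t) (J * W * star J) at hmap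
  rw [hstar, hinv, ← cfc_comp_inv (fun x : ℝ => x ^ t) w
    (((Matrix.finite_real_spectrum (A := (w : Matrix n n ℝ))).image _).continuousOn _)
    (hw ▸ hW.1), hw] at hmap
  have h2 : cfc (fun x : ℝ => x⁻¹ ^ t) W = mpowR W (-t) := by
    unfold mpowR
    refine cfc_congr fun x hx => ?_
    have := spec_pos hW hx
    simp only [Real.inv_rpow this.le, Real.rpow_neg this.le]
  rw [h2] at hmap
  have h3 : J * mpowR W t = mpowR W (-t) * J := by
    rw [← hmap, mul_assoc _ Jᵀ J, hJ', mul_one]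
  rw [mul_assoc, h3, ← mul_assoc, mpowR_mul hW, add_neg_cancel, mpowR_zero hW, one_mul]

end helpers

/-- `S_t` is symplectic, `S_t S_tᵀ = (SSᵀ) #_t γ`, and `S_0 = S`. -/
theorem Smat_symplectic (N : ℕ) (hN : 1 ≤ N)
    (S γ : Matrix (Fin (2*N)) (Fin (2*N)) ℝ)
    (hS : S * symp N * Sᵀ = symp N)
    (hγpd : γ.PosDef)
    (hγpure : γ = symp N * γ⁻¹ * (symp N)ᵀ)
    (t : ℝ) :
    Smat N S γ t * symp N * (Smat N S γ t)ᵀ = symp N ∧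
      Smat N S γ t * (Smat N S γ t)ᵀ = geomMeanR t (S * Sᵀ) γ ∧
      Smat N S γ 0 = S := by
  have hJ := symp_mul_transpose N
  have hJt := symp_transpose N
  unfold Smat
  generalize symp N = J at *
  have hJ' : Jᵀ * J = 1 := mul_eq_one_comm.1 hJ
  -- S is invertible
  have hS1 : S * (J * Sᵀ * Jᵀ) = 1 := by
    rw [← mul_assoc, ← mul_assoc, hS, hJ]
  have hSu : IsUnit S := IsUnit.of_mul_eq_one _ hS1
  have hS2 : J * Sᵀ * Jᵀ * S = 1 := mul_eq_one_comm.1 hS1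
  have hS3 : Sᵀ * J * S = J := by
    have h : Sᵀ * Jᵀ * S = Jᵀ := by
      calc Sᵀ * Jᵀ * S = (Jᵀ * J) * (Sᵀ * Jᵀ * S) := by rw [hJ', one_mul]
        _ = Jᵀ * (J * Sᵀ * Jᵀ * S) := by simp only [mul_assoc]
        _ = Jᵀ := by rw [hS2, mul_one]
    rw [hJt] at h
    simpa using h
  have hApd : (S * Sᵀ).PosDef := by
    have := (Matrix.IsUnit.posDef_star_right_conjugate_iff (x := 1) hSu).2 Matrix.PosDef.one
    rwa [mul_one, Matrix.star_eq_conjTranspose,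
      Matrix.conjTranspose_eq_transpose_of_trivial] at this
  have hAJ : (S * Sᵀ) * J * (S * Sᵀ) = J := by
    calc (S * Sᵀ) * J * (S * Sᵀ) = S * (Sᵀ * J * S) * Sᵀ := by simp only [mul_assoc]
      _ = J := by rw [hS3, hS]
  have hSS : S * Sᵀ = S * Sᵀ := rfl
  generalize hA : S * Sᵀ = A at *
  have hγJ : γ * J * γ = J := by
    have hu : IsUnit γ.det := (Matrix.isUnit_iff_isUnit_det _).1 hγpd.isUnit
    calc γ * J * γ = (J * γ⁻¹ * Jᵀ) * J * γ := by rw [← hγpure]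
      _ = J * (γ⁻¹ * (Jᵀ * J) * γ) := by simp only [mul_assoc]
      _ = J := by rw [hJ', mul_one, Matrix.nonsing_inv_mul _ hu, mul_one]
  have conjJ : ∀ P W : Matrix (Fin (2*N)) (Fin (2*N)) ℝ, P * J * P = J → W * J * W = J →
      (P * W * P) * J * (P * W * P) = J := by
    intro P W hP hW
    calc (P * W * P) * J * (P * W * P) = P * (W * (P * J * P) * W) * P := by
          simp only [mul_assoc]
      _ = J := by rw [hP, hW, hP]
  have hMpd := conj_posDef hγpd (mpowR_isUnit hApd (-(1/2))) (mpowR_herm A (-(1/2)))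
  have hMJ := conjJ _ _ (mpowR_symp hJ hApd hAJ (-(1/2))) hγJ
  have hGpd : (geomMeanR t A γ).PosDef :=
    conj_posDef (mpowR_posDef hMpd t) (mpowR_isUnit hApd (1/2)) (mpowR_herm A (1/2))
  have hGJ : geomMeanR t A γ * J * geomMeanR t A γ = J :=
    conjJ _ _ (mpowR_symp hJ hApd hAJ (1/2)) (mpowR_symp hJ hMpd hMJ t)
  have hG0 : geomMeanR 0 A γ = A := by
    unfold geomMeanR
    rw [mpowR_zero hMpd, mul_one, mpowR_mul hApd, add_halves, mpowR_one hApd]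
  generalize geomMeanR t A γ = G at *
  have hQ : (msqrt A)⁻¹ = mpowR A (-(1/2)) := by
    rw [msqrt_eq]
    apply Matrix.inv_eq_right_inv
    rw [mpowR_mul hApd, add_neg_cancel, mpowR_zero hApd]
  have hQJ := mpowR_symp hJ hApd hAJ (-(1/2))
  have hRJ := mpowR_symp hJ hGpd hGJ (1/2)
  have hQA : mpowR A (-(1/2)) * A * mpowR A (-(1/2)) = 1 := by
    nth_rewrite 2 [← mpowR_one hApd]
    rw [mpowR_mul hApd, mpowR_mul hApd, ← mpowR_zero hApd]
    norm_num
  have hT : (mpowR G (1/2) * mpowR A (-(1/2)) * S)ᵀ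
      = Sᵀ * (mpowR A (-(1/2)) * mpowR G (1/2)) := by
    rw [Matrix.transpose_mul, Matrix.transpose_mul, mpowR_transpose, mpowR_transpose]
  refine ⟨?_, ?_, ?_⟩
  · rw [hQ, msqrt_eq, hT]
    calc _ = mpowR G (1/2) * (mpowR A (-(1/2)) * (S * J * Sᵀ) * mpowR A (-(1/2)))
              * mpowR G (1/2) := by simp only [mul_assoc]
      _ = J := by rw [hS, hQJ, hRJ]
  · rw [hQ, msqrt_eq, hT]
    calc _ = mpowR G (1/2) * (mpowR A (-(1/2)) * (S * Sᵀ) * mpowR A (-(1/2)))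
              * mpowR G (1/2) := by simp only [mul_assoc]
      _ = G := by rw [hA, hQA, mul_one, mpowR_mul hGpd, add_halves, mpowR_one hGpd]
  · rw [hG0, hQ, msqrt_eq, mpowR_mul hApd, add_neg_cancel, mpowR_zero hApd, one_mul]
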